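/- Let n ≥ 1 be an integer and suppose < is a left-invariant linear order on G_n with 1 < b⁻¹·a. Then it is not the case that 1 < a, 1 < b, c < 1, and d < 1 all hold (Case 4 is impossible). -/

import Mathlib

/-- The four generators of the Kanenobu group `G n`. -/
inductive Gen : Type
  | a | b | c | d
  deriving DecidableEq

open FreeGroup in
/-- The four relators of the presentation of `G n`. -/
def kanenobuRels (n : ℕ) : Set (FreeGroup Gen) :=
  { ((of Gen.a)⁻¹ * of Gen.b) ^ (10 * n) * (of Gen.d)⁻¹ * (of Gen.a) ^ 2,
    ((of Gen.b)⁻¹) ^ 2 * of Gen.c * ((of Gen.b)⁻¹ * of Gen.a) ^ (10 * n),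
    ((of Gen.d)⁻¹ * of Gen.c) ^ (10 * n + 3) * (of Gen.c)⁻¹ * of Gen.b * ((of Gen.c)⁻¹) ^ 2,
    (of Gen.d) ^ 2 * (of Gen.a)⁻¹ * of Gen.d * ((of Gen.c)⁻¹ * of Gen.d) ^ (10 * n + 3) }

/-- The group `G n`, fundamental group of the double branched cover of `K_{-10n,10n+3}`. -/
abbrev G (n : ℕ) : Type := PresentedGroup (kanenobuRels n)

/-- The image of the generator `a` in `G n`. -/
def ga (n : ℕ) : G n := PresentedGroup.of Gen.a
/-- The image of the generator `b` in `G n`. -/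
def gb (n : ℕ) : G n := PresentedGroup.of Gen.b
/-- The image of the generator `c` in `G n`. -/
def gc (n : ℕ) : G n := PresentedGroup.of Gen.c
/-- The image of the generator `d` in `G n`. -/
def gd (n : ℕ) : G n := PresentedGroup.of Gen.d

/-- `lt` is a left-invariant linear (strict total) order on the group `G`. -/
def IsLeftInvariantLinearOrder (G : Type*) [Group G] (lt : G → G → Prop) : Prop :=
  IsStrictTotalOrder G lt ∧ ∀ f g h : G, lt g h → lt (f * g) (f * h)

theorem pow_mul_le_aux {H : Type*} [Group H] [LinearOrder H] [MulLeftStrictMono H] (x h : H)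
    (hx : x * h ≤ h) (k : ℕ) : x ^ k * h ≤ h := by
  have := mulLeftMono_of_mulLeftStrictMono H
  induction k with
  | zero => simp
  | succ k ih =>
    rw [pow_succ, mul_assoc]
    exact (mul_le_mul_right hx (x ^ k)).trans ih

theorem case4_aux {H : Type*} [Group H] [LinearOrder H] [MulLeftStrictMono H] (a b c d : H)
    (N M : ℕ)
    (h1 : (a⁻¹ * b) ^ N * d⁻¹ * a ^ 2 = 1)
    (h2 : (b⁻¹) ^ 2 * c * (b⁻¹ * a) ^ N = 1)
    (h3 : (d⁻¹ * c) ^ M * c⁻¹ * b * (c⁻¹) ^ 2 = 1)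
    (h4 : d ^ 2 * a⁻¹ * d * (c⁻¹ * d) ^ M = 1)
    (hb : 1 < b) (hc : c < 1) : False := by
  have := mulLeftMono_of_mulLeftStrictMono H
  have hC : 1 < c⁻¹ := by simpa using mul_lt_mul_right hc c⁻¹
  have hB : b⁻¹ < 1 := by simpa using mul_lt_mul_right hb b⁻¹
  have pos : ∀ {g h : H}, 1 < g → 1 < h → 1 < g * h := fun {g h} hg hh =>
    hg.trans (by simpa using mul_lt_mul_right hh g)
  have e1 : (b⁻¹ * a) ^ N = d⁻¹ * a ^ 2 := by
    have : (b⁻¹ * a) ^ N = ((a⁻¹ * b) ^ N)⁻¹ := by rw [← inv_pow]; simp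
    rw [this, inv_eq_iff_mul_eq_one, ← mul_assoc, h1]
  have e2 : (b⁻¹ * a) ^ N = c⁻¹ * b ^ 2 := by
    rw [eq_inv_of_mul_eq_one_right h2]; group
  have e3 : (c⁻¹ * d) ^ M = c⁻¹ * b * (c⁻¹) ^ 2 := by
    have : (c⁻¹ * d) ^ M = ((d⁻¹ * c) ^ M)⁻¹ := by rw [← inv_pow]; simp
    rw [this, inv_eq_iff_mul_eq_one, ← h3]; group
  have e4 : (c⁻¹ * d) ^ M = d⁻¹ * a * (d⁻¹) ^ 2 := by
    rw [eq_inv_of_mul_eq_one_right h4]; group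
  have w : c ^ 2 * b = d ^ 2 * a := by
    calc c ^ 2 * b = ((c⁻¹ * d) ^ M)⁻¹ * (b⁻¹ * a) ^ N := by rw [e3, e2]; group
      _ = d ^ 2 * a := by rw [e4, e1]; group
  have hz : 1 < c⁻¹ * d := by
    by_contra hz
    have := pow_mul_le_aux (c⁻¹ * d) 1 (by simpa using hz) M
    rw [e3, mul_one] at this
    exact absurd (pos (pos hC hb) (pow_two c⁻¹ ▸ pos hC hC)) (not_lt.2 this)
  have hx : b⁻¹ < (b⁻¹ * a) * b⁻¹ := by
    by_contra hx
    have := pow_mul_le_aux _ _ (not_lt.1 hx) N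
    rw [e2] at this
    have e : c⁻¹ * b ^ 2 * b⁻¹ = c⁻¹ * b := by group
    rw [e] at this
    exact absurd (hB.trans (pos hC hb)) (not_lt.2 this)
  have hab : 1 < a * b⁻¹ := by
    have := mul_lt_mul_right hx b
    simpa [mul_assoc] using this
  have eab : a * b⁻¹ = (c⁻¹ * ((c⁻¹ * d) * c) * (c⁻¹ * d))⁻¹ := by
    have : a = (d ^ 2)⁻¹ * (c ^ 2 * b) := by rw [w]; group
    rw [this]; group
  have hzc : (c⁻¹ * d) * c ≤ c := by
    by_contra h
    have h' : 1 < c⁻¹ * ((c⁻¹ * d) * c) := by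
      simpa using mul_lt_mul_right (not_le.1 h) c⁻¹
    have := pos hab (pos h' hz)
    rw [eab, inv_mul_cancel] at this
    exact lt_irrefl _ this
  have := pow_mul_le_aux _ _ hzc M
  rw [e3] at this
  have e : c⁻¹ * b * (c⁻¹) ^ 2 * c = c⁻¹ * b * c⁻¹ := by group
  rw [e] at this
  exact absurd (hc.trans (pos (pos hC hb) hC)) (not_lt.2 this)

/-- Case 4 (`a,b` positive, `c,d` negative) is impossible. -/
theorem case4_impossible (n : ℕ) (hn : 1 ≤ n) (lt : G n → G n → Prop)
    (hlt : IsLeftInvariantLinearOrder (G n) lt) (hba : lt 1 ((gb n)⁻¹ * ga n)) :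
    ¬ (lt 1 (ga n) ∧ lt 1 (gb n) ∧ lt (gc n) 1 ∧ lt (gd n) 1) := by
  classical
  rintro ⟨-, hb, hc, -⟩
  obtain ⟨hs, hm⟩ := hlt
  letI : LinearOrder (G n) := linearOrderOfSTO lt
  haveI : MulLeftStrictMono (G n) := ⟨fun f g h hgh => hm f g h hgh⟩
  have key : ∀ r ∈ kanenobuRels n, PresentedGroup.mk (kanenobuRels n) r = 1 :=
    fun r hr => PresentedGroup.one_of_mem hr
  exact case4_aux (ga n) (gb n) (gc n) (gd n) (10 * n) (10 * n + 3)
    (key _ (Or.inl rfl)) (key _ (Or.inr (Or.inl rfl)))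
    (key _ (Or.inr (Or.inr (Or.inl rfl)))) (key _ (Or.inr (Or.inr (Or.inr rfl)))) hb hc
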